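/- arXiv:2312.03181 — 4 statements merged into one kernel-verified Lean document; each statement's English description precedes it below -/
import Mathlib

section
/- Let d ≥ 2, let A be a real d×d matrix with ‖A‖ ≤ 1, and let 0 < ε < 1. Then there exists a real d×d matrix A′ such that ‖A′ − A‖ ≤ ε/2, ‖A′‖ ≤ max(1/2, 1 − ε/2), and s_d(A′) ≥ ε/2. -/
open Matrix

noncomputable section

/-- Operator norm of a real `d × d` matrix acting on Euclidean space. -/
def opNorm {d : ℕ} (M : Matrix (Fin d) (Fin d) ℝ) : ℝ :=
  ‖(Matrix.toEuclideanCLM (𝕜 := ℝ) M : EuclideanSpace ℝ (Fin d) →L[ℝ] EuclideanSpace ℝ (Fin d))‖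

/-- `sv M j` : the `j`-th singular value (1-indexed) of `M`, via the max-min
characterization `s_j(M) = max_{dim V = j} min_{v ∈ V, ‖v‖=1} ‖Mv‖`. -/
def sv {d : ℕ} (M : Matrix (Fin d) (Fin d) ℝ) (j : ℕ) : ℝ :=
  sSup {t : ℝ | ∃ V : Submodule ℝ (EuclideanSpace ℝ (Fin d)),
    Module.finrank ℝ V = j ∧ ∀ v ∈ V,
      t * ‖v‖ ≤ ‖(Matrix.toEuclideanCLM (𝕜 := ℝ) M : EuclideanSpace ℝ (Fin d) →L[ℝ] EuclideanSpace ℝ (Fin d)) v‖}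

/-- A linear endomorphism of a finite-dimensional real inner product space has a singular value
decomposition. -/
theorem exists_singular_bases {E : Type*} [NormedAddCommGroup E] [InnerProductSpace ℝ E]
    [FiniteDimensional ℝ E] {n : ℕ} (hn : Module.finrank ℝ E = n) (T : E →ₗ[ℝ] E) :
    ∃ v u : OrthonormalBasis (Fin n) ℝ E, ∀ i, T (v i) = ‖T (v i)‖ • u i := by
  have hS : (LinearMap.adjoint T ∘ₗ T).IsSymmetric := LinearMap.isSymmetric_adjoint_mul_self T
  set v := hS.eigenvectorBasis hn with hv
  have horth : ∀ i j, i ≠ j → inner ℝ (T (v i)) (T (v j)) = 0 := by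
    intro i j hij
    have h := hS.apply_eigenvectorBasis hn j
    rw [← hv, LinearMap.comp_apply] at h
    rw [← LinearMap.adjoint_inner_right, h, inner_smul_right, v.inner_eq_zero hij, mul_zero]
  have hon : Orthonormal ℝ
      (Set.domRestrict {i | T (v i) ≠ 0} fun i => ‖T (v i)‖⁻¹ • T (v i)) := by
    refine ⟨fun ⟨i, hi⟩ => ?_, fun ⟨i, _⟩ ⟨j, _⟩ hij => ?_⟩
    · exact norm_smul_inv_norm (𝕜 := ℝ) hi
    · have hij' : i ≠ j := fun h => hij (Subtype.ext h)
      change inner ℝ (‖T (v i)‖⁻¹ • T (v i)) (‖T (v j)‖⁻¹ • T (v j)) = 0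
      simp [inner_smul_left, inner_smul_right, horth i j hij']
  obtain ⟨u, hu⟩ := hon.exists_orthonormalBasis_extension_of_card_eq (by simp [hn])
  refine ⟨v, u, fun i => ?_⟩
  by_cases hi : T (v i) = 0
  · simp [hi]
  · rw [hu i hi, smul_smul, mul_inv_cancel₀ (norm_ne_zero_iff.mpr hi), one_smul]

section DiagonalMap

variable {ι E : Type*} [Fintype ι] [NormedAddCommGroup E] [InnerProductSpace ℝ E]

theorem norm_sq_map_of_apply_eq_smul (v u : OrthonormalBasis ι ℝ E) (c : ι → ℝ)
    (T : E →ₗ[ℝ] E) (hT : ∀ i, T (v i) = c i • u i) (x : E) :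
    ‖T x‖ ^ 2 = ∑ i, c i ^ 2 * v.repr x i ^ 2 := by
  have hx : T x = ∑ i, (v.repr x i * c i) • u i := by
    conv_lhs => rw [← v.sum_repr x]
    simp [hT, smul_smul]
  rw [← real_inner_self_eq_norm_sq, hx, u.orthonormal.inner_sum]
  refine Finset.sum_congr rfl fun i _ => ?_
  simp only [conj_trivial]
  ring

theorem norm_sq_eq_sum_repr_sq (v : OrthonormalBasis ι ℝ E) (x : E) :
    ‖x‖ ^ 2 = ∑ i, v.repr x i ^ 2 := by
  simpa using norm_sq_map_of_apply_eq_smul v v 1 LinearMap.id (by simp) x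

theorem norm_map_le_of_apply_eq_smul (v u : OrthonormalBasis ι ℝ E) (c : ι → ℝ)
    (T : E →ₗ[ℝ] E) (hT : ∀ i, T (v i) = c i • u i) {r : ℝ} (hr : 0 ≤ r)
    (hc : ∀ i, |c i| ≤ r) (x : E) : ‖T x‖ ≤ r * ‖x‖ := by
  refine le_of_sq_le_sq ?_ (by positivity)
  rw [mul_pow, norm_sq_map_of_apply_eq_smul v u c T hT, norm_sq_eq_sum_repr_sq v, Finset.mul_sum]
  refine Finset.sum_le_sum fun i _ => mul_le_mul_of_nonneg_right ?_ (sq_nonneg _)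
  exact sq_le_sq' (abs_le.mp (hc i)).1 (abs_le.mp (hc i)).2

theorem le_norm_map_of_apply_eq_smul (v u : OrthonormalBasis ι ℝ E) (c : ι → ℝ)
    (T : E →ₗ[ℝ] E) (hT : ∀ i, T (v i) = c i • u i) {r : ℝ} (hr : 0 ≤ r)
    (hc : ∀ i, r ≤ c i) (x : E) : r * ‖x‖ ≤ ‖T x‖ := by
  refine le_of_sq_le_sq ?_ (norm_nonneg _)
  rw [mul_pow, norm_sq_map_of_apply_eq_smul v u c T hT, norm_sq_eq_sum_repr_sq v, Finset.mul_sum]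
  exact Finset.sum_le_sum fun i _ =>
    mul_le_mul_of_nonneg_right (pow_le_pow_left₀ hr (hc i) 2) (sq_nonneg _)

end DiagonalMap

theorem le_sv_card {d : ℕ} (hd : 0 < d) (M : Matrix (Fin d) (Fin d) ℝ) {r : ℝ}
    (h : ∀ x, r * ‖x‖ ≤ ‖Matrix.toEuclideanCLM (𝕜 := ℝ) M x‖) : r ≤ sv M d := by
  refine le_csSup ⟨opNorm M, ?_⟩ ⟨⊤, by simp, fun x _ => h x⟩
  rintro t ⟨V, hV, ht⟩
  obtain ⟨x, hx, hx0⟩ := V.exists_mem_ne_zero_of_ne_bot (by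
    rintro rfl
    simp at hV
    omega)
  exact le_of_mul_le_mul_right ((ht x hx).trans (ContinuousLinearMap.le_opNorm _ x))
    (norm_pos_iff.mpr hx0)

/-- **Lemma (non-singular initialization).** For `d ≥ 2`, `‖A‖ ≤ 1` and `0 < ε < 1` there
is a matrix `A'` with `‖A' - A‖ ≤ ε/2`, `‖A'‖ ≤ max (1/2) (1 - ε/2)` and `s_d(A') ≥ ε/2`. -/
theorem stmt7 {d : ℕ} (hd : 2 ≤ d) (A : Matrix (Fin d) (Fin d) ℝ) (hA : opNorm A ≤ 1)
    {ε : ℝ} (hε0 : 0 < ε) (hε1 : ε < 1) :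
    ∃ A' : Matrix (Fin d) (Fin d) ℝ,
      opNorm (A' - A) ≤ ε / 2 ∧
      opNorm A' ≤ max (1 / 2) (1 - ε / 2) ∧
      ε / 2 ≤ sv A' d := by
  have hε : ε / 2 ≤ 1 - ε / 2 := by linarith
  set T := Matrix.toEuclideanCLM (𝕜 := ℝ) A with hTdef
  obtain ⟨v, u, hvu⟩ := exists_singular_bases finrank_euclideanSpace_fin T.toLinearMap
  set s : Fin d → ℝ := fun i => ‖T.toLinearMap (v i)‖
  have hs1 : ∀ i, s i ≤ 1 := fun i => by
    have h := T.le_opNorm (v i)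
    rw [v.norm_eq_one, mul_one] at h
    exact h.trans hA
  have hs0 : ∀ i, 0 ≤ s i := fun i => norm_nonneg _
  set c : Fin d → ℝ := fun i => max (ε / 2) (min (s i) (1 - ε / 2))
  have hc0 : ∀ i, ε / 2 ≤ c i := fun i => le_max_left _ _
  have hc1 : ∀ i, c i ≤ 1 - ε / 2 := fun i => max_le hε (min_le_right _ _)
  have hcs : ∀ i, |c i - s i| ≤ ε / 2 := fun i => by
    have h0 := hs0 i
    have h1 := hs1 i
    simp only [c, abs_le]
    grind
  set S := LinearMap.toContinuousLinearMap (v.toBasis.constr ℝ fun i => c i • u i)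
  have hS : ∀ i, S (v i) = c i • u i := fun i => by
    have h := v.toBasis.constr_basis ℝ (fun i => c i • u i) i
    rwa [v.coe_toBasis] at h
  have hM : Matrix.toEuclideanCLM (𝕜 := ℝ) (Matrix.toEuclideanCLM (𝕜 := ℝ).symm S) = S :=
    StarAlgEquiv.apply_symm_apply _ S
  refine ⟨Matrix.toEuclideanCLM (𝕜 := ℝ).symm S, ?_, ?_, le_sv_card (by omega) _ ?_⟩
  · rw [opNorm, map_sub, hM, ← hTdef]
    refine ContinuousLinearMap.opNorm_le_bound _ (by linarith) ?_
    refine norm_map_le_of_apply_eq_smul v u (fun i => c i - s i)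
      (S - T).toLinearMap (fun i => ?_) (by linarith) hcs
    have h : T (v i) = s i • u i := hvu i
    simp [hS, h, sub_smul]
  · rw [opNorm, hM]
    refine (ContinuousLinearMap.opNorm_le_bound _ (by linarith) ?_).trans (le_max_right _ _)
    refine norm_map_le_of_apply_eq_smul v u c S.toLinearMap hS (by linarith) fun i => ?_
    exact abs_le.mpr ⟨by linarith [hc0 i], hc1 i⟩
  · rw [hM]
    exact le_norm_map_of_apply_eq_smul v u c S.toLinearMap hS (by linarith) hc0
end
end

section
/- Let d > 1, 1 ≤ m ≤ m′ ≤ N − 1 and 0 < ε < 1. Suppose Â_m, …, Â_{m′} are real d×d matrices with ‖Â_i‖ ≤ 1 − ε/4 and s_d(Â_i) ≥ ε/4 for every m ≤ i ≤ m′. For each m ≤ i ≤ m′, let Ã_i be a real d×d matrix with |Ã_i − Â_i|_∞ < (ε/4)^N/(3dN). Then for every 1 ≤ j < k ≤ d, s_j(Ã_{m′}⋯Ã_m)/s_k(Ã_{m′}⋯Ã_m) ≥ (1/2)·s_j(Â_{m′}⋯Â_m)/s_k(Â_{m′}⋯Â_m). -/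
open Matrix

noncomputable section

/-- The (order-reversed) product `M m' * M (m'-1) * ⋯ * M m` of a block of matrices. -/
def blockProd {d : ℕ} (M : ℕ → Matrix (Fin d) (Fin d) ℝ) (m m' : ℕ) :
    Matrix (Fin d) (Fin d) ℝ :=
  ((List.range (m' + 1 - m)).map fun i => M (m' - i)).prod

section PerturbedProducts

variable {E : Type*} [NormedAddCommGroup E] [NormedSpace ℝ E]

theorem norm_prod_range_apply_le {F : ℕ → E →L[ℝ] E} {n : ℕ}
    (hF : ∀ i < n, ∀ v, ‖F i v‖ ≤ ‖v‖) (v : E) :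
    ‖((List.range n).map F).prod v‖ ≤ ‖v‖ := by
  induction n generalizing v with
  | zero => simp
  | succ n ih =>
    simpa [List.range_succ] using
      (ih (fun i hi => hF i (hi.trans n.lt_succ_self)) (F n v)).trans (hF n n.lt_succ_self v)

theorem pow_mul_norm_le_norm_prod_range_apply {F : ℕ → E →L[ℝ] E} {n : ℕ} {c : ℝ} (hc : 0 ≤ c)
    (hF : ∀ i < n, ∀ v, c * ‖v‖ ≤ ‖F i v‖) (v : E) :
    c ^ n * ‖v‖ ≤ ‖((List.range n).map F).prod v‖ := by
  induction n generalizing v with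
  | zero => simp
  | succ n ih =>
    have h := ih (fun i hi => hF i (hi.trans n.lt_succ_self)) (F n v)
    have h' := mul_le_mul_of_nonneg_left (hF n n.lt_succ_self v) (pow_nonneg hc n)
    simpa [List.range_succ, pow_succ, mul_assoc] using h'.trans h

theorem norm_prod_range_sub_apply_le {F G : ℕ → E →L[ℝ] E} {n : ℕ} {η : ℝ} (hη : 0 ≤ η)
    (hF : ∀ i < n, ∀ v, ‖F i v‖ ≤ ‖v‖) (hG : ∀ i < n, ∀ v, ‖G i v‖ ≤ ‖v‖)
    (hFG : ∀ i < n, ∀ v, ‖G i v - F i v‖ ≤ η * ‖v‖) (v : E) :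
    ‖((List.range n).map G).prod v - ((List.range n).map F).prod v‖ ≤ n * η * ‖v‖ := by
  induction n generalizing v with
  | zero => simp
  | succ n ih =>
    have hlt : ∀ {i}, i < n → i < n + 1 := fun hi => hi.trans n.lt_succ_self
    have h₁ := ih (fun i hi => hF i (hlt hi)) (fun i hi => hG i (hlt hi))
      (fun i hi => hFG i (hlt hi)) (G n v)
    have h₂ := norm_prod_range_apply_le (fun i hi => hF i (hlt hi)) (G n v - F n v)
    have h₃ := hFG n n.lt_succ_self v
    have h₄ := mul_le_mul_of_nonneg_left (hG n n.lt_succ_self v)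
      (mul_nonneg n.cast_nonneg hη : 0 ≤ (n : ℝ) * η)
    simp only [List.range_succ, List.map_append, List.map_cons, List.map_nil, List.prod_append,
      List.prod_singleton, ContinuousLinearMap.mul_def, ContinuousLinearMap.comp_apply]
    rw [map_sub] at h₂
    have h₅ := norm_sub_le_norm_sub_add_norm_sub (((List.range n).map G).prod (G n v))
      (((List.range n).map F).prod (G n v)) (((List.range n).map F).prod (F n v))
    push_cast
    linarith

end PerturbedProducts

section SingularValues

variable {d : ℕ}

local notation "clm" => Matrix.toEuclideanCLM (n := Fin d) (𝕜 := ℝ)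

theorem norm_toEuclideanCLM_apply_le_of_abs_le {M : Matrix (Fin d) (Fin d) ℝ} {δ : ℝ} (hδ : 0 ≤ δ)
    (hM : ∀ a b, |M a b| ≤ δ) (v : EuclideanSpace ℝ (Fin d)) : ‖clm M v‖ ≤ d * δ * ‖v‖ := by
  refine le_of_sq_le_sq ?_ (by positivity)
  rw [EuclideanSpace.real_norm_sq_eq, mul_pow, EuclideanSpace.real_norm_sq_eq v]
  calc ∑ a, (clm M v a) ^ 2
      ≤ ∑ _a : Fin d, (∑ _b : Fin d, δ ^ 2) * ∑ b, v b ^ 2 := by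
        refine Finset.sum_le_sum fun a _ => ?_
        have h : clm M v a = ∑ b, M a b * v b := by
          simp [Matrix.mulVec, dotProduct]
        rw [h]
        refine (Finset.sum_mul_sq_le_sq_mul_sq _ _ _).trans ?_
        refine mul_le_mul_of_nonneg_right (Finset.sum_le_sum fun b _ => ?_)
          (Finset.sum_nonneg fun b _ => sq_nonneg _)
        exact sq_le_sq' (abs_le.1 (hM a b)).1 (abs_le.1 (hM a b)).2
    _ = (d * δ) ^ 2 * ∑ b, v b ^ 2 := by
        simp
        ring

theorem exists_submodule_finrank_eq {j : ℕ} (hj : j ≤ d) :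
    ∃ V : Submodule ℝ (EuclideanSpace ℝ (Fin d)), Module.finrank ℝ V = j := by
  obtain ⟨f, hf⟩ := exists_linearIndependent_of_le_finrank (R := ℝ)
    (M := EuclideanSpace ℝ (Fin d)) (n := j) (by simpa using hj)
  exact ⟨Submodule.span ℝ (Set.range f), by simpa using finrank_span_eq_card hf⟩

theorem bddAbove_sv_set (M : Matrix (Fin d) (Fin d) ℝ) {j : ℕ} (hj : 1 ≤ j) :
    BddAbove {t : ℝ | ∃ V : Submodule ℝ (EuclideanSpace ℝ (Fin d)),
      Module.finrank ℝ V = j ∧ ∀ v ∈ V, t * ‖v‖ ≤ ‖clm M v‖} := by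
  refine ⟨‖clm M‖, ?_⟩
  rintro t ⟨V, hV, ht⟩
  have : Nontrivial V := Module.nontrivial_of_finrank_pos (R := ℝ) (by omega)
  obtain ⟨v, hv⟩ := exists_ne (0 : V)
  have hv' : 0 < ‖(v : EuclideanSpace ℝ (Fin d))‖ := by simpa using hv
  exact le_of_mul_le_mul_right ((ht v v.2).trans ((clm M).le_opNorm v)) hv'

theorem le_sv {M : Matrix (Fin d) (Fin d) ℝ} {c : ℝ} (hM : ∀ v, c * ‖v‖ ≤ ‖clm M v‖)
    {j : ℕ} (hj : 1 ≤ j) (hjd : j ≤ d) : c ≤ sv M j := by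
  obtain ⟨V, hV⟩ := exists_submodule_finrank_eq hjd
  exact le_csSup (bddAbove_sv_set M hj) ⟨V, hV, fun v _ => hM v⟩

theorem sv_le_mul_sv {A B : Matrix (Fin d) (Fin d) ℝ} {c : ℝ} (hc : 0 < c)
    (h : ∀ v, ‖clm A v‖ ≤ c * ‖clm B v‖) {j : ℕ} (hj : 1 ≤ j) (hjd : j ≤ d) :
    sv A j ≤ c * sv B j := by
  obtain ⟨V, hV⟩ := exists_submodule_finrank_eq hjd
  refine csSup_le ⟨0, V, hV, fun v _ => by simp⟩ ?_
  rintro t ⟨W, hW, ht⟩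
  rw [← div_le_iff₀' hc]
  refine le_csSup (bddAbove_sv_set B hj) ⟨W, hW, fun v hv => ?_⟩
  rw [div_mul_eq_mul_div, div_le_iff₀' hc]
  exact (ht v hv).trans (h v)

theorem sv_self_mul_norm_le (M : Matrix (Fin d) (Fin d) ℝ) (v : EuclideanSpace ℝ (Fin d)) :
    sv M d * ‖v‖ ≤ ‖clm M v‖ := by
  rcases eq_or_ne v 0 with rfl | hv
  · simp
  rw [← le_div_iff₀ (norm_pos_iff.2 hv)]
  refine csSup_le ⟨0, ⊤, by simp, fun v _ => by simp⟩ ?_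
  rintro t ⟨V, hV, ht⟩
  have hV : V = ⊤ := Submodule.eq_top_of_finrank_eq (by simpa using hV)
  rw [le_div_iff₀ (norm_pos_iff.2 hv)]
  exact ht v (hV ▸ Submodule.mem_top)

theorem toEuclideanCLM_blockProd (M : ℕ → Matrix (Fin d) (Fin d) ℝ) (m m' : ℕ) :
    clm (blockProd M m m') =
      ((List.range (m' + 1 - m)).map fun i => clm (M (m' - i))).prod := by
  rw [blockProd, map_list_prod, List.map_map]
  rfl

end SingularValues

/-- **Lemma (triangle inequality for target blocks).** If the targets `Ahat m, …, Ahat m'` have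
norm at most `1 - ε/4` and smallest singular value at least `ε/4`, and each `Atil i` is
entrywise within `(ε/4)^N / (3dN)` of `Ahat i`, then for all `1 ≤ j < k ≤ d` the singular
value ratio `s_j/s_k` of the perturbed block is at least half that of the target block. -/
theorem stmt8 {d N m m' : ℕ} (hd : 1 < d) (hm : 1 ≤ m) (hmm' : m ≤ m') (hm'N : m' ≤ N - 1)
    {ε : ℝ} (hε0 : 0 < ε) (hε1 : ε < 1)
    (Ahat Atil : ℕ → Matrix (Fin d) (Fin d) ℝ)
    (hnorm : ∀ i, m ≤ i → i ≤ m' → opNorm (Ahat i) ≤ 1 - ε / 4)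
    (hsd : ∀ i, m ≤ i → i ≤ m' → ε / 4 ≤ sv (Ahat i) d)
    (hclose : ∀ i, m ≤ i → i ≤ m' → ∀ a b : Fin d,
      |(Atil i - Ahat i) a b| < (ε / 4) ^ N / (3 * d * N : ℝ)) :
    ∀ j k : ℕ, 1 ≤ j → j < k → k ≤ d →
      (1 / 2) * (sv (blockProd Ahat m m') j / sv (blockProd Ahat m m') k) ≤
        sv (blockProd Atil m m') j / sv (blockProd Atil m m') k := by
  intro j k hj hjk hkd
  set c := ε / 4 with hc
  set n := m' + 1 - m with hn
  set η := c ^ N / (3 * N) with hη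
  have hc0 : 0 < c := by positivity
  have hc1 : c ≤ 1 := by linarith
  have hN : 1 ≤ N := by omega
  have hN' : (1 : ℝ) ≤ N := by exact_mod_cast hN
  have hd' : (0 : ℝ) < d := by exact_mod_cast (by omega : 0 < d)
  have hη0 : 0 ≤ η := by positivity
  have hηc : η ≤ c := by
    have h : c ^ N ≤ c := pow_le_of_le_one hc0.le hc1 (by omega)
    rw [hη, div_le_iff₀ (by positivity)]
    nlinarith
  have hnη : n * η ≤ c ^ N / 3 := by
    have h : (n : ℝ) ≤ N := by exact_mod_cast (by omega : n ≤ N)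
    calc n * η ≤ N * η := by gcongr
      _ = c ^ N / 3 := by rw [hη]; field_simp
  have hidx : ∀ i < n, m ≤ m' - i ∧ m' - i ≤ m' := fun i hi => by omega
  set F := fun i => Matrix.toEuclideanCLM (n := Fin d) (𝕜 := ℝ) (Ahat (m' - i))
  set G := fun i => Matrix.toEuclideanCLM (n := Fin d) (𝕜 := ℝ) (Atil (m' - i))
  have hF_le : ∀ i < n, ∀ v, ‖F i v‖ ≤ (1 - c) * ‖v‖ := fun i hi v =>
    (F i).le_of_opNorm_le (hnorm _ (hidx i hi).1 (hidx i hi).2) v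
  have hle_F : ∀ i < n, ∀ v, c * ‖v‖ ≤ ‖F i v‖ := fun i hi v =>
    (mul_le_mul_of_nonneg_right (hsd _ (hidx i hi).1 (hidx i hi).2) (norm_nonneg v)).trans
      (sv_self_mul_norm_le _ v)
  have hFG : ∀ i < n, ∀ v, ‖G i v - F i v‖ ≤ η * ‖v‖ := fun i hi v => by
    have h := norm_toEuclideanCLM_apply_le_of_abs_le (by positivity)
      (fun a b => (hclose _ (hidx i hi).1 (hidx i hi).2 a b).le) v
    have h' : (d : ℝ) * (c ^ N / (3 * d * N)) = η := by rw [hη]; field_simp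
    rwa [h', map_sub] at h
  have hF_one : ∀ i < n, ∀ v, ‖F i v‖ ≤ ‖v‖ := fun i hi v => by
    nlinarith [hF_le i hi v, norm_nonneg v]
  have hG_one : ∀ i < n, ∀ v, ‖G i v‖ ≤ ‖v‖ := fun i hi v => by
    nlinarith [hF_le i hi v, hFG i hi v, norm_le_norm_add_norm_sub' (G i v) (F i v), norm_nonneg v]
  set P := blockProd Ahat m m' with hP
  set Q := blockProd Atil m m'
  have hle_P : ∀ v, c ^ N * ‖v‖ ≤ ‖Matrix.toEuclideanCLM (n := Fin d) (𝕜 := ℝ) P v‖ := fun v => by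
    rw [hP, toEuclideanCLM_blockProd]
    refine le_trans ?_ (pow_mul_norm_le_norm_prod_range_apply hc0.le hle_F v)
    exact mul_le_mul_of_nonneg_right (pow_le_pow_of_le_one hc0.le hc1 (by omega)) (norm_nonneg v)
  have hPQ : ∀ v, ‖Matrix.toEuclideanCLM (n := Fin d) (𝕜 := ℝ) Q v -
      Matrix.toEuclideanCLM (n := Fin d) (𝕜 := ℝ) P v‖ ≤
      ‖Matrix.toEuclideanCLM (n := Fin d) (𝕜 := ℝ) P v‖ / 3 := fun v => by
    have h := norm_prod_range_sub_apply_le hη0 hF_one hG_one hFG v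
    have h' := mul_le_mul_of_nonneg_right hnη (norm_nonneg v)
    rw [← toEuclideanCLM_blockProd, ← toEuclideanCLM_blockProd] at h
    linarith [hle_P v]
  have hj_le : sv P j ≤ 3 / 2 * sv Q j := sv_le_mul_sv (by norm_num)
    (fun v => by
      linarith [hPQ v, norm_le_norm_add_norm_sub (Matrix.toEuclideanCLM (n := Fin d) (𝕜 := ℝ) Q v)
        (Matrix.toEuclideanCLM (n := Fin d) (𝕜 := ℝ) P v)]) hj (by omega)
  have hk_le : sv P k ≤ 3 / 2 * sv Q k := sv_le_mul_sv (by norm_num)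
    (fun v => by
      linarith [hPQ v, norm_le_norm_add_norm_sub (Matrix.toEuclideanCLM (n := Fin d) (𝕜 := ℝ) Q v)
        (Matrix.toEuclideanCLM (n := Fin d) (𝕜 := ℝ) P v)]) (by omega) hkd
  have hk_ge : sv Q k ≤ 4 / 3 * sv P k := sv_le_mul_sv (by norm_num)
    (fun v => by
      linarith [hPQ v, norm_le_norm_add_norm_sub' (Matrix.toEuclideanCLM (n := Fin d) (𝕜 := ℝ) Q v)
        (Matrix.toEuclideanCLM (n := Fin d) (𝕜 := ℝ) P v)]) (by omega) hkd
  have hPj : 0 < sv P j := (pow_pos hc0 N).trans_le (le_sv hle_P hj (by omega))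
  have hPk : 0 < sv P k := (pow_pos hc0 N).trans_le (le_sv hle_P (by omega) hkd)
  have hQk : 0 < sv Q k := by linarith
  calc (1 / 2) * (sv P j / sv P k) = (2 / 3 * sv P j) / (4 / 3 * sv P k) := by
        field_simp
        norm_num
    _ ≤ sv Q j / sv Q k := by
        gcongr
        · linarith
        · linarith
end
end

section
/- Let d ∈ ℕ, 0 < ε < 1, G > 0 and 1 ≤ j < d. Suppose there exists N ∈ ℕ such that for every sequence M₁, …, M_{N−1} of invertible real d×d matrices there exist indices 1 ≤ m ≤ m′ ≤ N − 1 and near-identity perturbations M̂_m, …, M̂_{m′} of M_m, …, M_{m′} with s_j(M̂_{m′}⋯M̂_m)/s_{j+1}(M̂_{m′}⋯M̂_m) > G. Then the same holds with j replaced by d − j: there exists N′ ∈ ℕ such that for every sequence M₁, …, M_{N′−1} of invertible real d×d matrices there exist indices 1 ≤ m ≤ m′ ≤ N′ − 1 and near-identity perturbations M̂_m, …, M̂_{m′} with s_{d−j}(M̂_{m′}⋯M̂_m)/s_{d−j+1}(M̂_{m′}⋯M̂_m) > G. -/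
open Matrix

noncomputable section

/-- `M'` is a near-identity perturbation of `M` at scale `ε`: `M' = R * M` or `M' = M * R`
for some invertible `R` with `‖R - I‖ < ε/4` and `‖R⁻¹ - I‖ < ε/4`. -/
def NearIdPert {d : ℕ} (ε : ℝ) (M M' : Matrix (Fin d) (Fin d) ℝ) : Prop :=
  ∃ R : Matrix (Fin d) (Fin d) ℝ, IsUnit R ∧ opNorm (R - 1) < ε / 4 ∧
    opNorm (R⁻¹ - 1) < ε / 4 ∧ (M' = R * M ∨ M' = M * R)

/-- The span of the members of an orthonormal basis indexed by `s` has dimension `#s`, and its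
vectors have no component along the remaining members. -/
theorem OrthonormalBasis.exists_submodule_finrank_eq_card {E ι : Type*} [NormedAddCommGroup E]
    [InnerProductSpace ℝ E] [Fintype ι] (b : OrthonormalBasis ι ℝ E) (s : Finset ι) :
    ∃ V : Submodule ℝ E, Module.finrank ℝ V = s.card ∧ ∀ v ∈ V, ∀ i ∉ s, b.repr v i = 0 := by
  refine ⟨Submodule.span ℝ (Set.range fun i : s => b i), ?_, fun v hv i hi => ?_⟩
  · exact (finrank_span_eq_card
      (b.orthonormal.linearIndependent.comp _ Subtype.val_injective)).trans (Fintype.card_coe s)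
  · induction hv using Submodule.span_induction with
    | mem x hx =>
      classical
      obtain ⟨k, rfl⟩ := hx
      have : i ≠ k := fun h => hi (h ▸ k.2)
      simp [b.repr_self, this]
    | zero => simp
    | add x y _ _ hx hy => simp [hx, hy]
    | smul a x _ hx => simp [hx]

/-- The square of `‖T v‖` in an orthonormal eigenbasis of `T† T`. -/
theorem LinearMap.norm_apply_sq_eq_sum_singularValues {E F : Type*} [NormedAddCommGroup E]
    [InnerProductSpace ℝ E] [FiniteDimensional ℝ E] [NormedAddCommGroup F] [InnerProductSpace ℝ F]
    [FiniteDimensional ℝ F] (T : E →ₗ[ℝ] F) {n : ℕ} (hn : Module.finrank ℝ E = n) (v : E) :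
    ‖T v‖ ^ 2 = ∑ i : Fin n, T.singularValues i ^ 2 *
      (T.isSymmetric_adjoint_comp_self.eigenvectorBasis hn).repr v i ^ 2 := by
  set b := T.isSymmetric_adjoint_comp_self.eigenvectorBasis hn with hb
  have h : ‖T v‖ ^ 2 = inner ℝ v ((LinearMap.adjoint T ∘ₗ T) v) := by
    rw [LinearMap.comp_apply, LinearMap.adjoint_inner_right, real_inner_self_eq_norm_sq]
  rw [h, ← b.sum_inner_mul_inner]
  refine Finset.sum_congr rfl fun i _ => ?_
  rw [real_inner_comm, ← b.repr_apply_apply, ← b.repr_apply_apply, hb,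
    LinearMap.IsSymmetric.eigenvectorBasis_apply_self_apply, T.sq_singularValues_fin hn]
  rw [RCLike.ofReal_real_eq_id, id_eq]
  ring

/-- A linear map expands by at least `t` on a subspace of dimension `k + 1` and by at most `t` on
a subspace of dimension `n - k`, where `t` is its `k`-th singular value (counted from zero). -/
theorem LinearMap.exists_submodule_singularValues_le {E F : Type*} [NormedAddCommGroup E]
    [InnerProductSpace ℝ E] [FiniteDimensional ℝ E] [NormedAddCommGroup F] [InnerProductSpace ℝ F]
    [FiniteDimensional ℝ F] (T : E →ₗ[ℝ] F) {n : ℕ} (hn : Module.finrank ℝ E = n) (k : Fin n) :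
    (∃ V : Submodule ℝ E, Module.finrank ℝ V = k + 1 ∧
      ∀ v ∈ V, T.singularValues k * ‖v‖ ≤ ‖T v‖) ∧
    ∃ W : Submodule ℝ E, Module.finrank ℝ W = n - k ∧
      ∀ w ∈ W, ‖T w‖ ≤ T.singularValues k * ‖w‖ := by
  set b := T.isSymmetric_adjoint_comp_self.eigenvectorBasis hn with hb
  have hnorm (v : E) : (T.singularValues k * ‖v‖) ^ 2 =
      ∑ i, T.singularValues k ^ 2 * b.repr v i ^ 2 := by
    rw [mul_pow, ← b.repr.norm_map v, EuclideanSpace.real_norm_sq_eq, Finset.mul_sum]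
  constructor
  · obtain ⟨V, hV, hV0⟩ := b.exists_submodule_finrank_eq_card (Finset.Iic k)
    refine ⟨V, by rw [hV, Fin.card_Iic], fun v hv => ?_⟩
    refine le_of_sq_le_sq ?_ (norm_nonneg _)
    rw [hnorm, T.norm_apply_sq_eq_sum_singularValues hn]
    refine Finset.sum_le_sum fun i _ => ?_
    by_cases hi : i ∈ Finset.Iic k
    · gcongr
      · exact T.singularValues_nonneg _
      · exact T.singularValues_antitone (Fin.le_def.1 (Finset.mem_Iic.1 hi))
    · simp [← hb, hV0 v hv i hi]
  · obtain ⟨W, hW, hW0⟩ := b.exists_submodule_finrank_eq_card (Finset.Ici k)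
    refine ⟨W, by rw [hW, Fin.card_Ici], fun v hv => ?_⟩
    refine le_of_sq_le_sq ?_ (mul_nonneg (T.singularValues_nonneg _) (norm_nonneg _))
    rw [hnorm, T.norm_apply_sq_eq_sum_singularValues hn]
    refine Finset.sum_le_sum fun i _ => ?_
    by_cases hi : i ∈ Finset.Ici k
    · gcongr
      · exact T.singularValues_nonneg _
      · exact T.singularValues_antitone (Fin.le_def.1 (Finset.mem_Ici.1 hi))
    · simp [← hb, hW0 v hv i hi]

/-- A pair of subspaces of complementary dimensions (up to one) certifies a singular value. -/
theorem sv_eq_of_submodules {d k l : ℕ} (hkl : d < k + l) {M : Matrix (Fin d) (Fin d) ℝ} {t : ℝ}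
    {V W : Submodule ℝ (EuclideanSpace ℝ (Fin d))}
    (hV : Module.finrank ℝ V = k)
    (hVt : ∀ v ∈ V, t * ‖v‖ ≤ ‖Matrix.toEuclideanCLM (𝕜 := ℝ) M v‖)
    (hW : Module.finrank ℝ W = l)
    (hWt : ∀ w ∈ W, ‖Matrix.toEuclideanCLM (𝕜 := ℝ) M w‖ ≤ t * ‖w‖) :
    sv M k = t := by
  refine IsGreatest.csSup_eq ⟨⟨V, hV, hVt⟩, ?_⟩
  rintro s ⟨U, hU, hUs⟩
  have hnd : ¬ Disjoint U W := fun h => by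
    have := Submodule.finrank_add_finrank_le_of_disjoint h
    rw [hU, hW, finrank_euclideanSpace_fin] at this
    omega
  rw [Submodule.disjoint_def] at hnd
  push Not at hnd
  obtain ⟨x, hxU, hxW, hx⟩ := hnd
  exact le_of_mul_le_mul_right ((hUs x hxU).trans (hWt x hxW)) (norm_pos_iff.2 hx)

/-- The singular values of the inverse are the inverses of the singular values, in reverse
order. -/
theorem sv_inv {d k l : ℕ} (hk : 1 ≤ k) (hl : 1 ≤ l) (hkl : k + l = d + 1)
    {M : Matrix (Fin d) (Fin d) ℝ} (hM : IsUnit M) : sv M⁻¹ l = (sv M k)⁻¹ := by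
  set T := Matrix.toEuclideanCLM (𝕜 := ℝ) M with hT
  set S := Matrix.toEuclideanCLM (𝕜 := ℝ) M⁻¹ with hS
  have hdet := (Matrix.isUnit_iff_isUnit_det M).1 hM
  have hST (x) : S (T x) = x := by
    rw [hS, hT, ← mul_apply_eq_comp, ← map_mul, Matrix.nonsing_inv_mul _ hdet, map_one,
      one_apply_eq_self]
  have hinj : Function.Injective T := Function.LeftInverse.injective hST
  obtain ⟨⟨V, hV, hVt⟩, W, hW, hWt⟩ := T.toLinearMap.exists_submodule_singularValues_le
    (finrank_euclideanSpace_fin (𝕜 := ℝ) (n := d)) ⟨k - 1, by omega⟩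
  set t := T.toLinearMap.singularValues (⟨k - 1, by omega⟩ : Fin d).val
  have hVk : Module.finrank ℝ V = k := by rw [hV]; simp only; omega
  have hWl : Module.finrank ℝ W = l := by rw [hW]; simp only; omega
  have ht : 0 < t := by
    have : W ≠ ⊥ := by
      rintro rfl
      rw [finrank_bot] at hWl
      omega
    obtain ⟨w, hw, hw0⟩ := W.exists_mem_ne_zero_of_ne_bot this
    refine pos_of_mul_pos_left (lt_of_lt_of_le ?_ (hWt w hw)) (norm_nonneg w)
    exact norm_pos_iff.2 fun h => hw0 (hinj (h.trans (map_zero T).symm))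
  rw [sv_eq_of_submodules (by omega) hVk hVt hWl hWt]
  refine sv_eq_of_submodules (l := k) (V := W.map T.toLinearMap) (W := V.map T.toLinearMap)
    (by omega) ?_ ?_ ?_ ?_
  · rw [← hWl]
    exact (LinearEquiv.finrank_eq (W.equivMapOfInjective _ hinj)).symm
  · rintro _ ⟨w, hw, rfl⟩
    rw [inv_mul_le_iff₀ ht]
    exact (hWt w hw).trans_eq (congrArg (t * ‖·‖) (hST w).symm)
  · rw [← hVk]
    exact (LinearEquiv.finrank_eq (V.equivMapOfInjective _ hinj)).symm
  · rintro _ ⟨v, hv, rfl⟩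
    rw [le_inv_mul_iff₀ ht]
    exact (congrArg (t * ‖·‖) (hST v)).trans_le (hVt v hv)

theorem NearIdPert.inv {d : ℕ} {ε : ℝ} {M M' : Matrix (Fin d) (Fin d) ℝ}
    (h : NearIdPert ε M M') : NearIdPert ε M⁻¹ M'⁻¹ := by
  obtain ⟨R, hR, h1, h2, h3⟩ := h
  refine ⟨R⁻¹, Matrix.isUnit_nonsing_inv_iff.2 hR, h2, ?_, ?_⟩
  · rwa [Matrix.nonsing_inv_nonsing_inv _ ((Matrix.isUnit_iff_isUnit_det R).1 hR)]
  · rcases h3 with rfl | rfl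
    · exact Or.inr (Matrix.mul_inv_rev _ _)
    · exact Or.inl (Matrix.mul_inv_rev _ _)

theorem NearIdPert.isUnit {d : ℕ} {ε : ℝ} {M M' : Matrix (Fin d) (Fin d) ℝ}
    (h : NearIdPert ε M M') (hM : IsUnit M) : IsUnit M' := by
  obtain ⟨R, hR, -, -, rfl | rfl⟩ := h
  exacts [hR.mul hM, hM.mul hR]

theorem isUnit_blockProd {d : ℕ} {M : ℕ → Matrix (Fin d) (Fin d) ℝ} {m m' : ℕ}
    (h : ∀ i, m ≤ i → i ≤ m' → IsUnit (M i)) : IsUnit (blockProd M m m') := by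
  refine List.prod_isUnit fun A hA => ?_
  obtain ⟨i, hi, rfl⟩ := List.mem_map.1 hA
  rw [List.mem_range] at hi
  exact h _ (by omega) (by omega)

/-- The inverse of a block product is the block product of the inverses in reflected order. -/
theorem blockProd_inv_reflect {d : ℕ} (M : ℕ → Matrix (Fin d) (Fin d) ℝ) {m m' N : ℕ}
    (hm : m ≤ m') (hN : m' ≤ N) :
    blockProd (fun i => (M (N - i))⁻¹) (N - m') (N - m) = (blockProd M m m')⁻¹ := by
  unfold blockProd
  rw [Matrix.list_prod_inv_reverse]
  congr 1
  refine List.ext_getElem (by simp; omega) fun i h₁ h₂ => ?_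
  simp only [List.length_map, List.length_range] at h₁
  simp only [List.getElem_map, List.getElem_range, List.getElem_reverse, List.length_map,
    List.length_range]
  congr 2
  omega

/-- **Lemma (complementarity).** If (at scale `ε`, with gap threshold `G`) one can build a
gap between the `j`-th and `(j+1)`-st singular values, then one can build a gap between the
`(d-j)`-th and `(d-j+1)`-st singular values. -/
theorem stmt13 {d : ℕ} {ε G : ℝ} (hε0 : 0 < ε) (hε1 : ε < 1) (hG : 0 < G)
    {j : ℕ} (hj : 1 ≤ j) (hjd : j < d)
    (H : ∃ N : ℕ, ∀ M : ℕ → Matrix (Fin d) (Fin d) ℝ,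
      (∀ i, 1 ≤ i → i ≤ N - 1 → IsUnit (M i)) →
      ∃ m m' : ℕ, 1 ≤ m ∧ m ≤ m' ∧ m' ≤ N - 1 ∧
        ∃ M' : ℕ → Matrix (Fin d) (Fin d) ℝ,
          (∀ i, m ≤ i → i ≤ m' → NearIdPert ε (M i) (M' i)) ∧
          G < sv (blockProd M' m m') j / sv (blockProd M' m m') (j + 1)) :
    ∃ N' : ℕ, ∀ M : ℕ → Matrix (Fin d) (Fin d) ℝ,
      (∀ i, 1 ≤ i → i ≤ N' - 1 → IsUnit (M i)) →
      ∃ m m' : ℕ, 1 ≤ m ∧ m ≤ m' ∧ m' ≤ N' - 1 ∧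
        ∃ M' : ℕ → Matrix (Fin d) (Fin d) ℝ,
          (∀ i, m ≤ i → i ≤ m' → NearIdPert ε (M i) (M' i)) ∧
          G < sv (blockProd M' m m') (d - j) / sv (blockProd M' m m') (d - j + 1) := by
  obtain ⟨N, hN⟩ := H
  refine ⟨N, fun M hM => ?_⟩
  obtain ⟨m, m', hm, hmm, hm', M', hpert, hgap⟩ := hN (fun i => (M (N - i))⁻¹) fun i hi hiN =>
    Matrix.isUnit_nonsing_inv_iff.2 (hM _ (by omega) (by omega))
  have hunit : IsUnit (blockProd M' m m') := isUnit_blockProd fun i hi hi' =>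
    (hpert i hi hi').isUnit (Matrix.isUnit_nonsing_inv_iff.2 (hM _ (by omega) (by omega)))
  refine ⟨N - m', N - m, by omega, by omega, by omega, fun i => (M' (N - i))⁻¹,
    fun i hi hi' => ?_, ?_⟩
  · have hdet := (Matrix.isUnit_iff_isUnit_det (M i)).1 (hM i (by omega) (by omega))
    have := (hpert (N - i) (by omega) (by omega)).inv
    rwa [Nat.sub_sub_self (by omega), Matrix.nonsing_inv_nonsing_inv _ hdet] at this
  · rw [blockProd_inv_reflect M' hmm (by omega),
      sv_inv (k := j + 1) (by omega) (by omega) (by omega) hunit,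
      sv_inv (k := j) (by omega) (by omega) (by omega) hunit, inv_div_inv]
    exact hgap
end
end

section
/- Let d ≥ 2, 0 < ε < 1 and G > 1. Let M₁, …, M_{N−1} be invertible real d×d matrices with N − 1 ≥ (16/ε)·G·log G. Then there exist indices 1 ≤ m ≤ m′ < N and near-identity perturbations M̂_m, …, M̂_{m′} of M_m, …, M_{m′} such that s₁(M̂_{m′}⋯M̂_m)/s_d(M̂_{m′}⋯M̂_m) ≥ G. -/
open Matrix

noncomputable section

/-- The condition number of an invertible matrix dominates the ratio of its stretching factors in
any two directions. -/
theorem le_sv_one_div_sv_of_norm_le {d : ℕ} {A : Matrix (Fin d) (Fin d) ℝ} (hA : IsUnit A)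
    {G : ℝ} {x y : EuclideanSpace ℝ (Fin d)} (hx : x ≠ 0) (hy : y ≠ 0)
    (h : G * (‖toEuclideanCLM (𝕜 := ℝ) A y‖ * ‖x‖) ≤ ‖toEuclideanCLM (𝕜 := ℝ) A x‖ * ‖y‖) :
    G ≤ sv A 1 / sv A d := by
  set T := toEuclideanCLM (𝕜 := ℝ) A with hT
  have hx' : 0 < ‖x‖ := norm_pos_iff.2 hx
  have hy' : 0 < ‖y‖ := norm_pos_iff.2 hy
  have hinj : Function.Injective T := by
    obtain ⟨B, hBA⟩ := hA.exists_left_inv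
    have hBT : toEuclideanCLM (𝕜 := ℝ) B * T = 1 := by rw [hT, ← map_mul, hBA, map_one]
    exact Function.LeftInverse.injective (g := toEuclideanCLM (𝕜 := ℝ) B)
      fun p => DFunLike.congr_fun hBT p
  have h1 : ‖T x‖ / ‖x‖ ≤ sv A 1 := by
    refine le_csSup ⟨‖T‖, ?_⟩ ⟨ℝ ∙ x, finrank_span_singleton hx, ?_⟩
    · rintro t ⟨V, hV, ht⟩
      have : Nontrivial V := Module.nontrivial_of_finrank_pos (R := ℝ) (by omega)
      obtain ⟨⟨v, hvV⟩, hv⟩ := exists_ne (0 : V)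
      have hv0 : 0 < ‖v‖ := norm_pos_iff.2 fun h0 => hv (Subtype.ext h0)
      exact le_of_mul_le_mul_right ((ht v hvV).trans (T.le_opNorm v)) hv0
    · intro v hv
      obtain ⟨c, rfl⟩ := Submodule.mem_span_singleton.1 hv
      rw [← hT, map_smul, norm_smul, norm_smul]
      apply le_of_eq
      field_simp
  have hbound : ∀ t ∈ {t : ℝ | ∃ V : Submodule ℝ (EuclideanSpace ℝ (Fin d)),
      Module.finrank ℝ V = d ∧ ∀ v ∈ V, t * ‖v‖ ≤ ‖T v‖}, t ≤ ‖T y‖ / ‖y‖ := by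
    rintro t ⟨V, hV, ht⟩
    have : V = ⊤ := Submodule.eq_top_of_finrank_eq (by simpa using hV)
    rw [le_div_iff₀ hy']
    exact ht y (this ▸ Submodule.mem_top)
  have h2 : sv A d ≤ ‖T y‖ / ‖y‖ :=
    csSup_le ⟨0, ⊤, by simp, fun v _ => by simp⟩ hbound
  have h3 : 0 < sv A d := by
    obtain ⟨K, hK, hKT⟩ := T.toLinearMap.exists_antilipschitzWith (LinearMap.ker_eq_bot.2 hinj)
    have hK' : (0 : ℝ) < K := hK
    refine lt_of_lt_of_le (inv_pos.2 hK') (le_csSup ⟨_, hbound⟩ ⟨⊤, by simp, fun v _ => ?_⟩)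
    rw [inv_mul_le_iff₀ hK']
    simpa using hKT.le_mul_dist v 0
  rw [le_div_iff₀ h3]
  rcases le_or_gt G 0 with hG | hG
  · exact (mul_nonpos_of_nonpos_of_nonneg hG h3.le).trans ((by positivity : (0 : ℝ) ≤ _).trans h1)
  · calc G * sv A d ≤ G * (‖T y‖ / ‖y‖) := by gcongr
      _ ≤ ‖T x‖ / ‖x‖ := by
        rw [le_div_iff₀ hx', mul_div_assoc', div_mul_eq_mul_div, div_le_iff₀ hy', mul_assoc]
        exact h
      _ ≤ _ := h1

/-- A near-identity matrix stretching `a` by `1 + δ` and fixing `b`, provided that the angle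
between `a` and `b` is bounded below. -/
theorem exists_stretch {d : ℕ} {a b : EuclideanSpace ℝ (Fin d)} {K δ ε : ℝ} (ha : a ≠ 0)
    (hab : ∀ c : ℝ, ‖a‖ ≤ K * ‖a - c • b‖) (hδ : 0 < δ) (hδK : δ * K < ε) :
    ∃ R : Matrix (Fin d) (Fin d) ℝ, IsUnit R ∧ opNorm (R - 1) < ε ∧ opNorm (R⁻¹ - 1) < ε ∧
      toEuclideanCLM (𝕜 := ℝ) R a = (1 + δ) • a ∧ toEuclideanCLM (𝕜 := ℝ) R b = b := by
  set c : ℝ := inner ℝ b a / ‖b‖ ^ 2 with hc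
  set w := a - c • b with hw
  have ha' : 0 < ‖a‖ := norm_pos_iff.2 ha
  have hw0 : 0 < ‖w‖ := norm_pos_iff.2 fun h0 => by
    have := hab c
    rw [← hw, h0, norm_zero, mul_zero] at this
    linarith
  have hwb : inner ℝ w b = 0 := by
    rw [hw, inner_sub_left, real_inner_smul_left, real_inner_self_eq_norm_sq, hc,
      real_inner_comm]
    rcases eq_or_ne b 0 with rfl | hb
    · simp
    · have := norm_ne_zero_iff.2 hb
      field_simp
      ring
  have hwa : inner ℝ w a = ‖w‖ ^ 2 := by
    have : a = w + c • b := by rw [hw]; abel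
    rw [this, inner_add_right, real_inner_smul_right, hwb, real_inner_self_eq_norm_sq]
    ring
  set P : EuclideanSpace ℝ (Fin d) →L[ℝ] EuclideanSpace ℝ (Fin d) :=
    (‖w‖ ^ 2)⁻¹ • (innerSL ℝ w).smulRight a with hP
  have hPx : ∀ x, P x = ((‖w‖ ^ 2)⁻¹ * inner ℝ w x) • a := fun x => by
    simp [hP, smul_smul]
  have hPa : P a = a := by
    rw [hPx, hwa, inv_mul_cancel₀ (by positivity), one_smul]
  have hPb : P b = 0 := by rw [hPx, hwb, mul_zero, zero_smul]
  have hPP : ∀ x, P (P x) = P x := fun x => by rw [hPx x, map_smul, hPa]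
  have hPn : ‖P‖ ≤ K := by
    have h1 : ‖P‖ = ‖a‖ / ‖w‖ := by
      rw [hP, norm_smul, ContinuousLinearMap.norm_smulRight_apply, innerSL_apply_norm]
      simp only [norm_inv, norm_pow, norm_norm]
      field_simp
    rw [h1, div_le_iff₀ hw0]
    exact hab c
  set Φ := toEuclideanCLM (𝕜 := ℝ) (n := Fin d) with hΦ
  set R := Φ.symm (1 + δ • P) with hR
  set S := Φ.symm (1 - (δ / (1 + δ)) • P) with hS
  have hRS : R * S = 1 := by
    rw [hR, hS, ← map_mul]
    have : (1 + δ • P) * (1 - (δ / (1 + δ)) • P) = 1 := by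
      ext1 x
      simp only [mul_apply_eq_comp, one_apply_eq_self, _root_.add_apply, _root_.sub_apply,
        _root_.smul_apply, map_sub, map_smul, hPP]
      match_scalars
      · simp
      · field_simp
        ring
    rw [this, map_one]
  have hΦR : Φ R = 1 + δ • P := Φ.apply_symm_apply _
  have hΦS : Φ S = 1 - (δ / (1 + δ)) • P := Φ.apply_symm_apply _
  refine ⟨R, IsUnit.of_mul_eq_one S hRS, ?_, ?_, ?_, ?_⟩
  · rw [opNorm, map_sub, map_one, ← hΦ, hΦR, add_sub_cancel_left, norm_smul,
      Real.norm_of_nonneg hδ.le]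
    exact (by gcongr : δ * ‖P‖ ≤ δ * K).trans_lt hδK
  · rw [Matrix.inv_eq_right_inv hRS, opNorm, map_sub, map_one, ← hΦ, hΦS, sub_sub_cancel_left,
      norm_neg, norm_smul, Real.norm_of_nonneg (by positivity)]
    have : δ / (1 + δ) ≤ δ := div_le_self hδ.le (by linarith)
    exact (by gcongr : δ / (1 + δ) * ‖P‖ ≤ δ * K).trans_lt hδK
  · simp [hΦR, hPa, add_smul]
  · simp [hΦR, hPb]

theorem blockProd_one_zero {d : ℕ} (M : ℕ → Matrix (Fin d) (Fin d) ℝ) :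
    blockProd M 1 0 = 1 := by
  simp [blockProd]

theorem blockProd_one_succ {d : ℕ} (M : ℕ → Matrix (Fin d) (Fin d) ℝ) (k : ℕ) :
    blockProd M 1 (k + 1) = M (k + 1) * blockProd M 1 k := by
  simp only [blockProd, Nat.add_sub_cancel, List.range_succ_eq_map, List.map_cons, List.map_map,
    List.prod_cons, Nat.sub_zero]
  congr 3
  funext i
  simp

theorem isUnit_blockProd_one {d : ℕ} {M : ℕ → Matrix (Fin d) (Fin d) ℝ} {n : ℕ}
    (hM : ∀ i, 1 ≤ i → i ≤ n → IsUnit (M i)) {k : ℕ} (hk : k ≤ n) :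
    IsUnit (blockProd M 1 k) := by
  induction k with
  | zero => rw [blockProd_one_zero]; exact isUnit_one
  | succ k ih =>
    rw [blockProd_one_succ]
    exact (hM _ (by omega) hk).mul (ih (by omega))

theorem le_one_add_pow {ε G : ℝ} {n : ℕ} (hε0 : 0 < ε) (hε1 : ε < 1) (hG : 1 < G)
    (hn : (16 / ε) * G * Real.log G ≤ n) : G ≤ (1 + ε / (8 * G)) ^ n := by
  have hG0 : 0 < G := by linarith
  set δ := ε / (8 * G) with hδ
  have hδ0 : 0 < δ := by positivity
  have hδ1 : δ ≤ 1 := by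
    rw [hδ, div_le_one (by positivity)]
    linarith
  have hlog : δ / 2 ≤ Real.log (1 + δ) := by
    have h1 := Real.one_sub_inv_le_log_of_pos (by linarith : 0 < 1 + δ)
    have h2 : 1 - (1 + δ)⁻¹ = δ / (1 + δ) := by field_simp; ring
    rw [h2] at h1
    exact (by gcongr; linarith : δ / 2 ≤ δ / (1 + δ)).trans h1
  rw [← Real.log_le_log_iff hG0 (by positivity), Real.log_pow]
  have hlG : 0 ≤ Real.log G := Real.log_nonneg hG.le
  calc Real.log G = (16 / ε) * G * Real.log G * (δ / 2) := by rw [hδ]; field_simp; ring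
    _ ≤ n * Real.log (1 + δ) := by gcongr

theorem exists_orthonormal_pair {d : ℕ} (hd : 2 ≤ d)
    (f : EuclideanSpace ℝ (Fin d) → ℝ) :
    ∃ u v : EuclideanSpace ℝ (Fin d), ‖u‖ = 1 ∧ ‖v‖ = 1 ∧ inner ℝ u v = 0 ∧ f v ≤ f u := by
  have h : ∀ i j : Fin d, i ≠ j → inner ℝ (EuclideanSpace.single i (1 : ℝ))
      (EuclideanSpace.single j (1 : ℝ)) = (0 : ℝ) := fun i j hij => by
    simp [EuclideanSpace.inner_single_left, hij]
  have hne : (⟨0, by omega⟩ : Fin d) ≠ ⟨1, by omega⟩ := by simp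
  rcases le_total (f (EuclideanSpace.single (⟨0, by omega⟩ : Fin d) (1 : ℝ)))
    (f (EuclideanSpace.single (⟨1, by omega⟩ : Fin d) (1 : ℝ))) with hf | hf
  · exact ⟨_, _, by simp, by simp, h _ _ hne.symm, hf⟩
  · exact ⟨_, _, by simp, by simp, h _ _ hne, hf⟩

/-- **Lemma (target for the extremal singular value gap).** For `d ≥ 2`, `0 < ε < 1`,
`G > 1` and invertible `M 1, …, M (N-1)` with `N - 1 ≥ (16/ε) G log G`, there is a sub-block
`m ≤ ⋯ ≤ m' < N` of near-identity perturbations whose product has `s₁/s_d ≥ G`. -/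
theorem stmt16 {d N : ℕ} (hd : 2 ≤ d) {ε G : ℝ} (hε0 : 0 < ε) (hε1 : ε < 1) (hG : 1 < G)
    (M : ℕ → Matrix (Fin d) (Fin d) ℝ) (hM : ∀ i, 1 ≤ i → i ≤ N - 1 → IsUnit (M i))
    (hN : (16 / ε) * G * Real.log G ≤ (N : ℝ) - 1) :
    ∃ m m' : ℕ, 1 ≤ m ∧ m ≤ m' ∧ m' < N ∧
      ∃ M' : ℕ → Matrix (Fin d) (Fin d) ℝ,
        (∀ i, m ≤ i → i ≤ m' → NearIdPert ε (M i) (M' i)) ∧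
        G ≤ sv (blockProd M' m m') 1 / sv (blockProd M' m m') d := by
  obtain ⟨n, rfl⟩ : ∃ n, N = n + 2 := by
    have : 0 < (16 / ε) * G * Real.log G := by
      have := Real.log_pos hG
      positivity
    have h1 : (1 : ℝ) < N := by linarith
    have h2 : 1 < N := by exact_mod_cast h1
    exact ⟨N - 2, by omega⟩
  rw [show n + 2 - 1 = n + 1 from rfl] at hM
  have hG0 : 0 < G := by linarith
  by_cases hgood : ∃ k, 1 ≤ k ∧ k ≤ n + 1 ∧ G ≤ sv (blockProd M 1 k) 1 / sv (blockProd M 1 k) d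
  · obtain ⟨k, hk1, hkn, hk⟩ := hgood
    refine ⟨1, k, le_rfl, hk1, by omega, M, fun i _ _ => ⟨1, isUnit_one, ?_, ?_, ?_⟩, hk⟩
    · simpa [opNorm] using hε0
    · simpa [opNorm] using hε0
    · simp
  push Not at hgood
  set A : ℕ → EuclideanSpace ℝ (Fin d) →L[ℝ] EuclideanSpace ℝ (Fin d) :=
    fun k => toEuclideanCLM (𝕜 := ℝ) (blockProd M 1 k) with hA
  have hA0 : A 0 = 1 := by simp [hA, blockProd_one_zero]
  have hAs : ∀ k, A (k + 1) = toEuclideanCLM (𝕜 := ℝ) (M (k + 1)) * A k := fun k => by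
    simp [hA, blockProd_one_succ]
  have hcond : ∀ k, k ≤ n + 1 → ∀ x y, x ≠ 0 → y ≠ 0 → ‖A k x‖ * ‖y‖ ≤ G * (‖A k y‖ * ‖x‖) := by
    intro k hk x y hx hy
    rcases Nat.eq_zero_or_pos k with rfl | hk0
    · rw [hA0, one_apply_eq_self, one_apply_eq_self, mul_comm ‖y‖]
      exact le_mul_of_one_le_left (by positivity) hG.le
    · by_contra! hlt
      exact (hgood k hk0 hk).not_ge
        (le_sv_one_div_sv_of_norm_le (isUnit_blockProd_one hM hk) hx hy hlt.le)
  obtain ⟨u, v, hu, hv, huv, hfuv⟩ := exists_orthonormal_pair hd fun x => ‖A (n + 1) x‖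
  have hu0 : u ≠ 0 := norm_ne_zero_iff.1 (by rw [hu]; exact one_ne_zero)
  have hv0 : v ≠ 0 := norm_ne_zero_iff.1 (by rw [hv]; exact one_ne_zero)
  set δ := ε / (8 * G) with hδ
  have hδ0 : 0 < δ := by positivity
  have hδG : δ * G < ε / 4 := by
    have : δ * G = ε / 8 := by rw [hδ]; field_simp
    linarith
  have hstretch : ∀ k, ∃ R : Matrix (Fin d) (Fin d) ℝ, k ≤ n + 1 → IsUnit R ∧
      opNorm (R - 1) < ε / 4 ∧ opNorm (R⁻¹ - 1) < ε / 4 ∧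
      toEuclideanCLM (𝕜 := ℝ) R (A k u) = (1 + δ) • A k u ∧
      toEuclideanCLM (𝕜 := ℝ) R (A k v) = A k v := by
    intro k
    by_cases hk : k ≤ n + 1
    swap
    · exact ⟨1, fun h => absurd h hk⟩
    have hsub : ∀ c : ℝ, 1 ≤ ‖u - c • v‖ := fun c => by
      have h1 : ‖u - c • v‖ ^ 2 = 1 + c ^ 2 := by
        rw [norm_sub_sq_real, real_inner_smul_right, huv, hu, norm_smul, hv]
        simp
      nlinarith [norm_nonneg (u - c • v), sq_nonneg c]
    have hab : ∀ c : ℝ, ‖A k u‖ ≤ G * ‖A k u - c • A k v‖ := fun c => by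
      have h1 := hsub c
      have h2 := hcond k hk u (u - c • v) hu0
        (norm_pos_iff.1 (by linarith))
      rw [hu, mul_one, map_sub, map_smul] at h2
      exact (le_mul_of_one_le_right (norm_nonneg _) h1).trans h2
    have hAu : A k u ≠ 0 := fun h0 => by
      obtain ⟨B, hB⟩ := (isUnit_blockProd_one hM hk).exists_left_inv
      have : toEuclideanCLM (𝕜 := ℝ) B * A k = 1 := by rw [hA, ← map_mul, hB, map_one]
      have hBu := DFunLike.congr_fun this u
      rw [mul_apply_eq_comp, h0, map_zero, one_apply_eq_self] at hBu
      exact hu0 hBu.symm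
    obtain ⟨R, hR⟩ := exists_stretch hAu hab hδ0 hδG
    exact ⟨R, fun _ => hR⟩
  choose R hR using hstretch
  set M' : ℕ → Matrix (Fin d) (Fin d) ℝ := fun i => M i * R (i - 1) with hM'
  have hprod : ∀ k, k ≤ n + 1 →
      toEuclideanCLM (𝕜 := ℝ) (blockProd M' 1 k) u = (1 + δ) ^ k • A k u ∧
      toEuclideanCLM (𝕜 := ℝ) (blockProd M' 1 k) v = A k v := by
    intro k hk
    induction k with
    | zero => simp [blockProd_one_zero, hA0]
    | succ k ih =>
      obtain ⟨ih1, ih2⟩ := ih (by omega)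
      obtain ⟨-, -, -, hRu, hRv⟩ := hR k (by omega)
      rw [blockProd_one_succ, hAs]
      simp only [hM', Nat.add_sub_cancel, map_mul, mul_apply_eq_comp] at ih1 ih2 ⊢
      rw [ih1, ih2, hRv]
      simp only [map_smul, hRu, smul_smul, pow_succ, and_true]
  have hM'u : ∀ i, 1 ≤ i → i ≤ n + 1 → IsUnit (M' i) := fun i h1 hi =>
    (hM i h1 hi).mul (hR (i - 1) (by omega)).1
  refine ⟨1, n + 1, le_rfl, by omega, by omega, M', fun i h1 hi => ?_, ?_⟩
  · obtain ⟨hRi, hRn, hRn', -⟩ := hR (i - 1) (by omega)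
    exact ⟨_, hRi, hRn, hRn', Or.inr rfl⟩
  · obtain ⟨h1, h2⟩ := hprod (n + 1) le_rfl
    refine le_sv_one_div_sv_of_norm_le (isUnit_blockProd_one hM'u le_rfl) hu0 hv0 ?_
    have hpow : G ≤ (1 + δ) ^ (n + 1) := le_one_add_pow hε0 hε1 hG (by push_cast at hN ⊢; linarith)
    rw [h1, h2, hu, hv, norm_smul, mul_one, mul_one, Real.norm_of_nonneg (by positivity)]
    gcongr
end
end
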